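/- Let f ∈ PL⁺(S¹) and let n ≥ 1 be such that fⁿ has a fixed point. Then f is strongly reversible in PL(S¹) by an element of PL⁻(S¹) if and only if fⁿ is strongly reversible in PL(S¹) by an element of PL⁻(S¹). -/

import Mathlib

open Set Real Filter

/-- A function `ℝ → ℝ` is piecewise linear: its set of break points is locally
finite, and off the break points the function is locally affine. -/
def IsPLFun (f : ℝ → ℝ) : Prop :=
  ∃ B : Set ℝ, (∀ r : ℝ, (B ∩ Set.Icc (-r) r).Finite) ∧
    ∀ x ∉ B, ∃ a b : ℝ, ∀ᶠ y in nhds x, f y = a * y + b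

/-- `F : ℝ → ℝ` is a lift of the circle map `f` with degree `k`. -/
def IsLift (f : Circle → Circle) (F : ℝ → ℝ) (k : ℝ) : Prop :=
  (∀ x : ℝ, f (Circle.exp (2 * π * x)) = Circle.exp (2 * π * F x)) ∧
    ∀ x : ℝ, F (x + 1) = F x + k

/-- orientation-preserving piecewise linear homeomorphism of the circle -/
def PLplus (f : Circle ≃ₜ Circle) : Prop :=
  ∃ F : ℝ → ℝ, StrictMono F ∧ IsPLFun F ∧ IsLift f F 1

/-- orientation-reversing piecewise linear homeomorphism of the circle -/
def PLminus (f : Circle ≃ₜ Circle) : Prop :=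
  ∃ F : ℝ → ℝ, StrictAnti F ∧ IsPLFun F ∧ IsLift f F (-1)

/-- piecewise linear homeomorphism of the circle -/
def PLcirc (f : Circle ≃ₜ Circle) : Prop := PLplus f ∨ PLminus f

open Topology

/-- one-sided affine germs everywhere -/
def PLl (f : ℝ → ℝ) : Prop :=
  ∀ x, (∃ a b : ℝ, ∀ᶠ y in 𝓝[>] x, f y = a * y + b) ∧
    (∃ a b : ℝ, ∀ᶠ y in 𝓝[<] x, f y = a * y + b)

lemma affine_of_local {f : ℝ → ℝ} {U : Set ℝ} (hU : IsPreconnected U) (hne : U.Nonempty)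
    (h : ∀ x ∈ U, ∃ a b : ℝ, ∀ᶠ y in 𝓝 x, f y = a * y + b) :
    ∃ a b : ℝ, ∀ y ∈ U, f y = a * y + b := by
  obtain ⟨z, hz⟩ := hne
  obtain ⟨a, b, hab⟩ := h z hz
  have han : ∀ a b : ℝ, ∀ x, AnalyticAt ℝ (fun y : ℝ => a * y + b) x := fun a b x => by fun_prop
  refine ⟨a, b, fun y hy => ?_⟩
  refine AnalyticOnNhd.eqOn_of_preconnected_of_eventuallyEq (𝕜 := ℝ) (f := f)
    (g := fun y => a * y + b) (U := U) ?_ (fun x _ => han a b x) hU hz hab hy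
  intro x hx
  obtain ⟨a', b', h'⟩ := h x hx
  exact (han a' b' x).congr (EventuallyEq.symm h')

lemma IsPLFun.pll {f : ℝ → ℝ} (h : IsPLFun f) : PLl f := by
  obtain ⟨B, hB, hf⟩ := h
  intro x
  have key : ∀ᶠ y in 𝓝[≠] x, y ∉ B := by
    have hfin := hB (|x| + 1)
    have h1 : ((B ∩ Icc (-(|x| + 1)) (|x| + 1)) \ {x})ᶜ ∈ 𝓝 x :=
      (hfin.subset sdiff_subset).isClosed.isOpen_compl.mem_nhds (by simp)
    have h2 : Icc (-(|x| + 1)) (|x| + 1) ∈ 𝓝 x :=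
      Icc_mem_nhds (by linarith [neg_abs_le x]) (by linarith [le_abs_self x])
    rw [eventually_nhdsWithin_iff]
    filter_upwards [h1, h2] with y hy1 hy2 hy3 hy4
    exact hy1 ⟨⟨hy4, hy2⟩, hy3⟩
  constructor
  · have h1 : ∀ᶠ y in 𝓝[>] x, y ∉ B := key.filter_mono (nhdsWithin_mono _ (fun y hy => ne_of_gt hy))
    obtain ⟨u, hu, hs⟩ := mem_nhdsGT_iff_exists_Ioo_subset.1 h1
    obtain ⟨a, b, hab⟩ := affine_of_local (f := f) (isPreconnected_Ioo (a := x) (b := u))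
      (nonempty_Ioo.2 hu) (fun y hy => hf y (hs hy))
    exact ⟨a, b, mem_of_superset (Ioo_mem_nhdsGT hu) hab⟩
  · have h1 : ∀ᶠ y in 𝓝[<] x, y ∉ B := key.filter_mono (nhdsWithin_mono _ (fun y hy => ne_of_lt hy))
    obtain ⟨u, hu, hs⟩ := mem_nhdsLT_iff_exists_Ioo_subset.1 h1
    obtain ⟨a, b, hab⟩ := affine_of_local (f := f) (isPreconnected_Ioo (a := u) (b := x))
      (nonempty_Ioo.2 hu) (fun y hy => hf y (hs hy))
    exact ⟨a, b, mem_of_superset (Ioo_mem_nhdsLT hu) hab⟩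

lemma PLl.isPLFun {f : ℝ → ℝ} (h : PLl f) : IsPLFun f := by
  refine ⟨{x | ¬ ∃ a b : ℝ, ∀ᶠ y in 𝓝 x, f y = a * y + b}, fun r => ?_, fun x hx => ?_⟩
  · have hloc : ∀ x : ℝ, ∀ᶠ y in 𝓝[≠] x, ∃ a b : ℝ, ∀ᶠ z in 𝓝 y, f z = a * z + b := by
      intro x
      obtain ⟨⟨a, b, h1⟩, ⟨a', b', h2⟩⟩ := h x
      rw [← Iio_union_Ioi, nhdsWithin_union, eventually_sup]
      constructor
      · obtain ⟨u, hu, hs⟩ := mem_nhdsLT_iff_exists_Ioo_subset.1 h2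
        filter_upwards [Ioo_mem_nhdsLT hu] with w hw
        exact ⟨a', b', mem_of_superset (isOpen_Ioo.mem_nhds hw) hs⟩
      · obtain ⟨u, hu, hs⟩ := mem_nhdsGT_iff_exists_Ioo_subset.1 h1
        filter_upwards [Ioo_mem_nhdsGT hu] with w hw
        exact ⟨a, b, mem_of_superset (isOpen_Ioo.mem_nhds hw) hs⟩
    choose U hU using fun x => (eventually_nhdsWithin_iff.1 (hloc x)).exists_mem
    obtain ⟨t, -, ht⟩ := (isCompact_Icc (a := -r) (b := r)).elim_nhds_subcover U
      (fun x _ => (hU x).1)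
    refine t.finite_toSet.subset ?_
    rintro y ⟨hy1, hy2⟩
    obtain ⟨x, hx, hxy⟩ := mem_iUnion₂.1 (ht hy2)
    by_contra hne
    refine hy1 ((hU x).2 y hxy ?_)
    rintro rfl
    exact hne hx
  · by_contra hc; exact hx hc

lemma tgt {f : ℝ → ℝ} (hf : StrictMono f) (hc : Continuous f) (x : ℝ) :
    Tendsto f (𝓝[>] x) (𝓝[>] (f x)) :=
  tendsto_nhdsWithin_iff.2 ⟨(hc.tendsto x).mono_left nhdsWithin_le_nhds,
    eventually_nhdsWithin_of_forall fun _ hy => hf hy⟩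

lemma tlt {f : ℝ → ℝ} (hf : StrictMono f) (hc : Continuous f) (x : ℝ) :
    Tendsto f (𝓝[<] x) (𝓝[<] (f x)) :=
  tendsto_nhdsWithin_iff.2 ⟨(hc.tendsto x).mono_left nhdsWithin_le_nhds,
    eventually_nhdsWithin_of_forall fun _ hy => hf hy⟩

lemma agt {f : ℝ → ℝ} (hf : StrictAnti f) (hc : Continuous f) (x : ℝ) :
    Tendsto f (𝓝[>] x) (𝓝[<] (f x)) :=
  tendsto_nhdsWithin_iff.2 ⟨(hc.tendsto x).mono_left nhdsWithin_le_nhds,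
    eventually_nhdsWithin_of_forall fun _ hy => hf hy⟩

lemma alt' {f : ℝ → ℝ} (hf : StrictAnti f) (hc : Continuous f) (x : ℝ) :
    Tendsto f (𝓝[<] x) (𝓝[>] (f x)) :=
  tendsto_nhdsWithin_iff.2 ⟨(hc.tendsto x).mono_left nhdsWithin_le_nhds,
    eventually_nhdsWithin_of_forall fun _ hy => hf hy⟩

lemma aff_comp {f g : ℝ → ℝ} {l m : Filter ℝ} (h : Tendsto f l m)
    (hf : ∃ a b : ℝ, ∀ᶠ y in l, f y = a * y + b)
    (hg : ∃ a b : ℝ, ∀ᶠ y in m, g y = a * y + b) :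
    ∃ a b : ℝ, ∀ᶠ y in l, g (f y) = a * y + b := by
  obtain ⟨a, b, hf⟩ := hf
  obtain ⟨c, d, hg⟩ := hg
  refine ⟨c * a, c * b + d, ?_⟩
  filter_upwards [hf, h.eventually hg] with y h1 h2
  rw [h2, h1]; ring

open Equiv

lemma mono_cont {A : Perm ℝ} (h : StrictMono A) : Continuous A :=
  h.monotone.continuous_of_surjective A.surjective

lemma anti_cont {A : Perm ℝ} (h : StrictAnti A) : Continuous A := by
  have : Continuous (fun x => - A x) := by
    apply Monotone.continuous_of_surjective
    · intro x y hxy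
      exact neg_le_neg (h.antitone hxy)
    · intro y
      exact ⟨A⁻¹ (-y), by simp⟩
  convert this.neg using 1
  ext x; simp

lemma PLl.comp_mono {g : ℝ → ℝ} {A : Perm ℝ} (hg : PLl g) (hA : PLl A) (h : StrictMono A) :
    PLl (fun x => g (A x)) := fun x =>
  ⟨aff_comp (tgt h (mono_cont h) x) (hA x).1 (hg _).1,
    aff_comp (tlt h (mono_cont h) x) (hA x).2 (hg _).2⟩

lemma PLl.comp_anti {g : ℝ → ℝ} {A : Perm ℝ} (hg : PLl g) (hA : PLl A) (h : StrictAnti A) :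
    PLl (fun x => g (A x)) := fun x =>
  ⟨aff_comp (agt h (anti_cont h) x) (hA x).1 (hg _).2,
    aff_comp (alt' h (anti_cont h) x) (hA x).2 (hg _).1⟩

lemma inv_mono {A : Perm ℝ} (h : StrictMono A) : StrictMono (A⁻¹ : Perm ℝ) := by
  intro x y hxy
  rw [← h.lt_iff_lt]; simpa using hxy

lemma aff_inv {f g : ℝ → ℝ} {l m : Filter ℝ} (h : Tendsto f l m)
    (hfg : ∀ y, g (f y) = y)
    (hg : ∃ a b : ℝ, ∀ᶠ y in m, g y = a * y + b) (hl : ∀ c : ℝ, ∃ᶠ y in l, y ≠ c) :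
    ∃ a b : ℝ, ∀ᶠ y in l, f y = a * y + b := by
  obtain ⟨a, b, hg⟩ := hg
  have h1 : ∀ᶠ y in l, y = a * f y + b := by
    filter_upwards [h.eventually hg] with y hy
    rw [← hy, hfg]
  have ha : a ≠ 0 := by
    rintro rfl
    obtain ⟨y, hy1, hy2⟩ := ((hl b).and_eventually h1).exists
    simp at hy2
    exact hy1 hy2
  refine ⟨a⁻¹, - (a⁻¹ * b), ?_⟩
  filter_upwards [h1] with y hy
  field_simp
  linarith

lemma fr_gt (x c : ℝ) : ∃ᶠ y in 𝓝[>] x, y ≠ c := by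
  apply Eventually.frequently
  rcases le_or_gt c x with h | h
  · filter_upwards [self_mem_nhdsWithin] with y hy
    exact ne_of_gt (lt_of_le_of_lt h hy)
  · filter_upwards [Ioo_mem_nhdsGT h] with y hy
    exact ne_of_lt hy.2

lemma fr_lt (x c : ℝ) : ∃ᶠ y in 𝓝[<] x, y ≠ c := by
  apply Eventually.frequently
  rcases le_or_gt x c with h | h
  · filter_upwards [self_mem_nhdsWithin] with y hy
    exact ne_of_lt (lt_of_lt_of_le hy h)
  · filter_upwards [Ioo_mem_nhdsLT h] with y hy
    exact ne_of_gt hy.1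

lemma PLl.inv {A : Perm ℝ} (hA : PLl A) (h : StrictMono A) : PLl (A⁻¹ : Perm ℝ) := by
  intro x
  have hi := inv_mono h
  exact ⟨aff_inv (tgt hi (mono_cont hi) x) (fun y => by simp) (hA _).1 (fr_gt _),
    aff_inv (tlt hi (mono_cont hi) x) (fun y => by simp) (hA _).2 (fr_lt _)⟩

/-- the group of increasing PL bijections of the line -/
def PLG : Subgroup (Perm ℝ) where
  carrier := {A | StrictMono A ∧ PLl A}
  mul_mem' := fun {A B} hA hB => ⟨hA.1.comp hB.1, hA.2.comp_mono hB.2 hB.1⟩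
  one_mem' := ⟨strictMono_id, fun x => ⟨⟨1, 0, by simp⟩, ⟨1, 0, by simp⟩⟩⟩
  inv_mem' := fun {A} hA => ⟨inv_mono hA.1, hA.2.inv hA.1⟩

lemma zfix {K : Perm ℝ} {c : ℝ} (h : K c = c) (i : ℤ) : (K ^ i) c = c :=
  Perm.zpow_apply_eq_self_of_apply_eq_self h i

lemma comm_app {A K : Perm ℝ} (h : Commute A K) (x : ℝ) : A (K x) = K (A x) := by
  have := congrArg (fun e : Perm ℝ => e x) h.eq
  simpa using this

lemma zmono {K : Perm ℝ} (h : K ∈ PLG) (i : ℤ) : StrictMono (K ^ i : Perm ℝ) :=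
  (zpow_mem h i).1

lemma agree_aux {A B K : Perm ℝ} (hA : A ∈ PLG) (hB : B ∈ PLG) (hK : K ∈ PLG)
    (cA : Commute A K) (cB : Commute B K) {y p : ℝ} (hp : K p = p) (hpy : p ≤ y)
    (hKy : K y < y) (hAB : A y = B y) (z : ℝ) (h1 : ∃ i : ℤ, (K ^ i) y ≤ z)
    (h2 : ∃ j : ℤ, z ≤ (K ^ j) y) : A z = B z := by
  set u : ℕ → ℝ := fun j => (K ^ (j : ℤ)) y with hu
  have hus : ∀ j, u (j + 1) = K (u j) := by
    intro j
    simp only [hu]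
    rw [← Perm.mul_apply, ← zpow_one_add]
    congr 2; push_cast; ring
  have hlt : ∀ j, u (j + 1) < u j := by
    intro j
    have : u (j + 1) = (K ^ (j : ℤ)) (K y) := by
      simp only [hu]
      rw [← Perm.mul_apply, ← zpow_add_one]
      congr 2
    rw [this]
    exact zmono hK _ hKy
  have hanti : Antitone u := antitone_nat_of_succ_le fun j => (hlt j).le
  have hbd : BddBelow (range u) := ⟨p, by
    rintro _ ⟨j, rfl⟩
    have := (zmono hK (j : ℤ)).monotone hpy
    rwa [zfix hp] at this⟩
  have hlim := tendsto_atTop_ciInf hanti hbd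
  set c := ⨅ i, u i with hc
  have hcle : ∀ j, c ≤ u j := fun j => ciInf_le hbd j
  have hKc : K c = c := by
    have t1 : Tendsto (fun j => u (j + 1)) atTop (𝓝 c) := hlim.comp (tendsto_add_atTop_nat 1)
    have t2 : Tendsto (fun j => K (u j)) atTop (𝓝 (K c)) :=
      ((mono_cont hK.1).tendsto c).comp hlim
    simp only [← hus] at t2
    exact tendsto_nhds_unique t2 t1
  have hclt : c < y := lt_of_le_of_lt (hcle 1) (by simpa [hu] using hKy)
  have hABz : ∀ i : ℤ, ∀ w, A ((K ^ i) w) = B ((K ^ i) w) ↔ A w = B w := by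
    intro i w
    rw [comm_app (cA.zpow_right i), comm_app (cB.zpow_right i)]
    exact (K ^ i : Perm ℝ).injective.eq_iff
  have hcz : c < z := by
    obtain ⟨i, hi⟩ := h1
    refine lt_of_lt_of_le ?_ hi
    have := zmono hK i hclt
    rwa [zfix hKc] at this
  obtain ⟨a, b, ha⟩ := (hA.2 c).1
  obtain ⟨a', b', hb⟩ := (hB.2 c).1
  obtain ⟨v, hv, hs⟩ := mem_nhdsGT_iff_exists_Ioo_subset.1 (ha.and hb)
  obtain ⟨j0, hj0⟩ := (hlim.eventually (gt_mem_nhds hv)).exists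
  have hcu : ∀ j, c < u j := fun j => lt_of_le_of_lt (hcle (j + 1)) (hlt j)
  obtain ⟨e1, e2⟩ := hs ⟨hcu j0, hj0⟩
  obtain ⟨e3, e4⟩ := hs ⟨hcu (j0 + 1), (hlt j0).trans hj0⟩
  have e5 : A (u j0) = B (u j0) := (hABz _ _).2 hAB
  have e6 : A (u (j0 + 1)) = B (u (j0 + 1)) := (hABz _ _).2 hAB
  have haa : a = a' := by
    have : (a - a') * (u j0 - u (j0 + 1)) = 0 := by linarith
    rcases mul_eq_zero.1 this with h | h
    · linarith
    · have := hlt j0; linarith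
  have hbb : b = b' := by rw [haa] at e1; linarith
  obtain ⟨i, hi⟩ := h2
  rw [← hABz ((j0 : ℤ) - i)]
  have hin : (K ^ ((j0 : ℤ) - i)) z ∈ Ioo c v := by
    constructor
    · have := zmono hK ((j0 : ℤ) - i) hcz
      rwa [zfix hKc] at this
    · refine lt_of_le_of_lt ((zmono hK ((j0 : ℤ) - i)).monotone hi) ?_
      rw [← Perm.mul_apply, ← zpow_add]
      simpa [hu] using hj0
  obtain ⟨e7, e8⟩ := hs hin
  rw [e7, e8, haa, hbb]

lemma agree {A B K : Perm ℝ} (hA : A ∈ PLG) (hB : B ∈ PLG) (hK : K ∈ PLG)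
    (cA : Commute A K) (cB : Commute B K) {y p : ℝ} (hp : K p = p) (hpy : p ≤ y)
    (hKy : K y ≠ y) (hAB : A y = B y) (z : ℝ) (h1 : ∃ i : ℤ, (K ^ i) y ≤ z)
    (h2 : ∃ j : ℤ, z ≤ (K ^ j) y) : A z = B z := by
  rcases lt_or_gt_of_ne hKy with h | h
  · exact agree_aux hA hB hK cA cB hp hpy h hAB z h1 h2
  · obtain ⟨i, hi⟩ := h1
    obtain ⟨j, hj⟩ := h2
    refine agree_aux hA hB (inv_mem hK) cA.inv_right cB.inv_right (p := p) ?_ hpy ?_ hAB z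
      ⟨-i, by simpa using hi⟩ ⟨-j, by simpa using hj⟩
    · simpa using zfix hp (-1)
    · rw [← hK.1.lt_iff_lt]; simpa using h

lemma hull_symm {K : Perm ℝ} (hK : K ∈ PLG) {x y : ℝ} {i : ℤ} :
    (K ^ i) x ≤ y ↔ x ≤ (K ^ (-i)) y := by
  rw [← (zmono hK i).le_iff_le (b := (K ^ (-i)) y), ← Perm.mul_apply, ← zpow_add]
  simp

lemma hull_symm' {K : Perm ℝ} (hK : K ∈ PLG) {x y : ℝ} {i : ℤ} :
    y ≤ (K ^ i) x ↔ (K ^ (-i)) y ≤ x := by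
  rw [← (zmono hK i).le_iff_le (a := (K ^ (-i)) y), ← Perm.mul_apply, ← zpow_add]
  simp

lemma pow_mono_pt {G : Perm ℝ} (hG : G ∈ PLG) {x : ℝ} (h : x ≤ G x) :
    Monotone (fun j : ℕ => (G ^ j) x) := monotone_nat_of_le_succ fun j => by
  rw [pow_succ, Perm.mul_apply]
  exact (pow_mem hG j).1.monotone h

lemma pow_anti_pt {G : Perm ℝ} (hG : G ∈ PLG) {x : ℝ} (h : G x ≤ x) :
    Antitone (fun j : ℕ => (G ^ j) x) := antitone_nat_of_succ_le fun j => by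
  rw [pow_succ, Perm.mul_apply]
  exact (pow_mem hG j).1.monotone h

lemma root_fix {G : Perm ℝ} (hG : G ∈ PLG) {d : ℕ} (hd : 1 ≤ d) {x : ℝ} (h : (G ^ d) x = x) :
    G x = x := by
  rcases le_total x (G x) with h1 | h1
  · have := pow_mono_pt hG h1 hd
    simp only [pow_one, h] at this
    exact le_antisymm this h1
  · have := pow_anti_pt hG h1 hd
    simp only [pow_one, h] at this
    exact le_antisymm h1 this

lemma root_aux {G H : Perm ℝ} (hG : G ∈ PLG) (hH : H ∈ PLG) {d : ℕ} (hd : 1 ≤ d)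
    (hGH : G ^ d = H ^ d) {x : ℝ} (hpf : ∀ y, ∃ p ≤ y, (G ^ d) p = p)
    (hx : (G ^ d) x ≠ x) (hlt : G x < H x) : False := by
  have hK : G ^ d ∈ PLG := pow_mem hG d
  have cG : Commute G (G ^ d) := Commute.self_pow G d
  have cH : Commute H (G ^ d) := by rw [hGH]; exact Commute.self_pow H d
  set K := G ^ d with hKd
  let U : Set ℝ := {z | (∃ i : ℤ, (K ^ i) x ≤ z) ∧ (∃ j : ℤ, z ≤ (K ^ j) x)}
  have hU : IsPreconnected U := by
    apply OrdConnected.isPreconnected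
    refine ⟨?_⟩
    rintro a ⟨⟨i, hi⟩, -⟩ b ⟨-, ⟨j, hj⟩⟩ c ⟨h1, h2⟩
    exact ⟨⟨i, hi.trans h1⟩, ⟨j, h2.trans hj⟩⟩
  have hxU : x ∈ U := ⟨⟨0, by simp⟩, ⟨0, by simp⟩⟩
  have hne : ∀ y ∈ U, G y ≠ H y := by
    rintro y ⟨⟨i, hi⟩, ⟨j, hj⟩⟩ he
    obtain ⟨p, hp, hpK⟩ := hpf y
    have hKy : K y ≠ y := by
      intro hKy
      rw [hull_symm hK, zfix hKy] at hi
      rw [hull_symm' hK, zfix hKy] at hj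
      exact hx (le_antisymm hi hj ▸ hKy)
    have := agree hG hH hK cG cH hpK hp hKy he x ⟨-j, (hull_symm' hK).1 hj⟩
      ⟨-i, (hull_symm hK).1 hi⟩
    exact hlt.ne this
  have hltU : ∀ y ∈ U, G y < H y := by
    intro y hy
    by_contra hcon
    obtain ⟨w, hw, hw2⟩ := hU.intermediate_value₂ hxU hy (mono_cont hG.1).continuousOn
      (mono_cont hH.1).continuousOn hlt.le (not_lt.1 hcon)
    exact hne w hw hw2
  have hmem : ∀ i ≤ d, (G ^ i) x ∈ U := by
    intro i hi
    have e1 : (K ^ (1 : ℤ)) x = (G ^ d) x := by simp [hKd]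
    rcases le_total x (G x) with h1 | h1
    · have m := pow_mono_pt hG h1
      exact ⟨⟨0, by simpa using m (Nat.zero_le i)⟩, ⟨1, by rw [e1]; exact m hi⟩⟩
    · have m := pow_anti_pt hG h1
      exact ⟨⟨1, by rw [e1]; exact m hi⟩, ⟨0, by simpa using m (Nat.zero_le i)⟩⟩
  have hind : ∀ i, i + 1 ≤ d → (G ^ (i + 1)) x < (H ^ (i + 1)) x := by
    intro i
    induction i with
    | zero => intro _; simpa using hlt
    | succ k ih =>
      intro hk
      rw [pow_succ' G, pow_succ' H, Perm.mul_apply, Perm.mul_apply]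
      exact (hltU _ (hmem _ (by omega))).trans (hH.1 (ih (by omega)))
  have := hind (d - 1) (by omega)
  rw [Nat.sub_add_cancel hd, ← hKd, hGH] at this
  exact lt_irrefl _ this

lemma root_unique {G H : Perm ℝ} (hG : G ∈ PLG) (hH : H ∈ PLG) {d : ℕ} (hd : 1 ≤ d)
    (hGH : G ^ d = H ^ d) (hpf : ∀ y, ∃ p ≤ y, (G ^ d) p = p) : G = H := by
  ext x
  by_cases hx : (G ^ d) x = x
  · rw [root_fix hG hd hx, root_fix hH hd (hGH ▸ hx)]
  · rcases lt_trichotomy (G x) (H x) with h | h | h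
    · exact (root_aux hG hH hd hGH hpf hx h).elim
    · exact h
    · rw [hGH] at hpf hx
      exact (root_aux hH hG hd hGH.symm hpf hx h).elim

lemma zstrict {Φ : Perm ℝ} (hΦ : Φ ∈ PLG) (hlt : ∀ x, x < Φ x) (b : ℝ) :
    StrictMono (fun i : ℤ => (Φ ^ i) b) := strictMono_int_of_lt_succ fun i => by
  rw [zpow_add_one, Perm.mul_apply]
  exact zmono hΦ i (hlt b)

lemma cell {Φ : Perm ℝ} (hΦ : Φ ∈ PLG) (hlt : ∀ x, x < Φ x)
    (hup : ∀ x y, ∃ M : ℤ, y < (Φ ^ M) x) (hdn : ∀ x y, ∃ M : ℤ, (Φ ^ M) x < y) (b x : ℝ) :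
    ∃ k : ℤ, (Φ ^ (k - 1)) b ≤ x ∧ x < (Φ ^ k) b := by
  have hs := zstrict hΦ hlt b
  obtain ⟨k, hk, hk2⟩ := Int.exists_greatest_of_bdd (P := fun k : ℤ => (Φ ^ k) b ≤ x)
    (by
      obtain ⟨M, hM⟩ := hup b x
      refine ⟨M, fun z hz => ?_⟩
      exact (hs.lt_iff_lt.1 (lt_of_le_of_lt hz hM)).le)
    (by
      obtain ⟨M, hM⟩ := hdn b x
      exact ⟨M, hM.le⟩)
  refine ⟨k + 1, by simpa using hk, ?_⟩
  by_contra hc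
  have := hk2 (k + 1) (not_lt.1 hc)
  omega

lemma anti_fix {S : Perm ℝ} (hS : StrictAnti S) : ∃ b, S b = b := by
  have hc := anti_cont hS
  rcases le_total (S 0) 0 with h | h
  · have h2 : S 0 ≤ S (S 0) := by
      have := hS.antitone h
      exact this
    obtain ⟨w, -, hw⟩ := isPreconnected_univ.intermediate_value₂ (mem_univ (0 : ℝ)) (mem_univ (S 0))
      hc.continuousOn continuous_id.continuousOn h h2
    exact ⟨w, hw⟩
  · have h2 : S (S 0) ≤ S 0 := by
      have := hS.antitone h
      exact this
    obtain ⟨w, -, hw⟩ := isPreconnected_univ.intermediate_value₂ (mem_univ (S 0)) (mem_univ (0 : ℝ))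
      hc.continuousOn continuous_id.continuousOn h2 h
    exact ⟨w, hw⟩

lemma step2 {Φ G S : Perm ℝ} (hΦ : Φ ∈ PLG) (hG : G ∈ PLG) (hS : StrictAnti S) (hSP : PLl S)
    (hSS : ∀ x, S (S x) = x) (hSG : ∀ x, G (S (G x)) = S x) (cΦG : Commute Φ G)
    (hlt : ∀ x, x < Φ x)
    (hup : ∀ x y, ∃ M : ℤ, y < (Φ ^ M) x) (hdn : ∀ x y, ∃ M : ℤ, (Φ ^ M) x < y)
    (hpf : ∀ y, ∃ p ≤ y, G p = p) :
    ∃ σ : Perm ℝ, StrictAnti σ ∧ PLl σ ∧ (∀ x, σ (σ x) = x) ∧ (∀ x, Φ (σ (Φ x)) = σ x) ∧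
      (∀ x, G (σ (G x)) = σ x) := by
  have hz : ∀ (i j : ℤ) x, (Φ ^ i) ((Φ ^ j) x) = (Φ ^ (i + j)) x := by
    intro i j x; rw [zpow_add, Perm.mul_apply]
  have hΦz : ∀ x, Φ x = (Φ ^ (1 : ℤ)) x := by simp
  have hΦS : StrictAnti (Φ * S : Perm ℝ) := hΦ.1.comp_strictAnti hS
  obtain ⟨b, hb⟩ := anti_fix hΦS
  rw [Perm.mul_apply] at hb
  have hSb : S b = (Φ ^ (-1 : ℤ)) b := by
    apply Φ.injective
    rw [hb, hΦz, hz]; simp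
  have hSb' : S ((Φ ^ (-1 : ℤ)) b) = b := by rw [← hSb, hSS]
  have hs := zstrict hΦ hlt b
  choose k hk1 hk2 using cell hΦ hlt hup hdn b
  let R : ℤ → ℝ → ℝ := fun k x => (Φ ^ (-k)) (S ((Φ ^ (-k)) x))
  have hRanti : ∀ k, StrictAnti (R k) := fun k =>
    (zmono hΦ (-k)).comp_strictAnti (hS.comp_strictMono (zmono hΦ (-k)))
  have hRPL : ∀ k, PLl (R k) := by
    intro k
    have h1 : PLl (Φ ^ (-k) : Perm ℝ) := (zpow_mem hΦ (-k)).2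
    have h2 : PLl (fun x => (Φ ^ (-k)) (S x)) := h1.comp_anti hSP hS
    exact h2.comp_mono h1 (zmono hΦ (-k))
  let s : ℝ → ℝ := fun x => R (k x) x
  have spec : ∀ (j : ℤ) x, (Φ ^ (j - 1)) b ≤ x → x ≤ (Φ ^ j) b → s x = R j x := by
    intro j x h1 h2
    have a1 : j - 1 < k x := hs.lt_iff_lt.1 (lt_of_le_of_lt h1 (hk2 x))
    have a2 : k x - 1 ≤ j := hs.le_iff_le.1 ((hk1 x).trans h2)
    rcases h2.lt_or_eq with h3 | h3
    · have a3 : k x - 1 < j := hs.lt_iff_lt.1 (lt_of_le_of_lt (hk1 x) h3)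
      have : k x = j := by omega
      simp only [s, this]
    · have a4 : j < k x := hs.lt_iff_lt.1 (h3 ▸ hk2 x)
      have : k x = j + 1 := by omega
      simp only [s, this, R]
      rw [h3, hz, hz]
      have e1 : -(j + 1) + j = -1 := by ring
      have e2 : -j + j = 0 := by ring
      rw [e1, e2, hSb', zpow_zero, Perm.one_apply, hSb, hz]
      congr 2; ring
  have hRcell : ∀ (j : ℤ) x, (Φ ^ (j - 1)) b ≤ x → x ≤ (Φ ^ j) b →
      (Φ ^ (-j - 1)) b ≤ R j x ∧ R j x ≤ (Φ ^ (-j)) b := by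
    intro j x h1 h2
    constructor
    · have := (hRanti j).antitone h2
      refine le_trans (le_of_eq ?_) this
      simp only [R]
      rw [hz, neg_add_cancel, zpow_zero, Perm.one_apply, hSb, hz]
      congr 2
    · have := (hRanti j).antitone h1
      refine le_trans this (le_of_eq ?_)
      simp only [R]
      rw [hz]
      have e1 : -j + (j - 1) = -1 := by ring
      rw [e1, hSb']
  have hss : ∀ x, s (s x) = x := by
    intro x
    have hc := hRcell (k x) x (hk1 x) (hk2 x).le
    rw [spec (-(k x)) (s x) hc.1 hc.2]
    simp only [s, R]
    rw [hz]; simp [hSS]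
  have hsanti : StrictAnti s := by
    intro x y hxy
    have hle : k x - 1 < k y := hs.lt_iff_lt.1 (lt_of_le_of_lt (hk1 x) (hxy.trans (hk2 y)))
    rcases (show k x ≤ k y by omega).lt_or_eq with h | h
    · have c1 := (hRcell (k x) x (hk1 x) (hk2 x).le).1
      have c2 := (hRcell (k y) y (hk1 y) (hk2 y).le).2
      have c3 : (Φ ^ (-(k y))) b ≤ (Φ ^ (-(k x) - 1)) b := hs.monotone (by omega)
      refine lt_of_le_of_ne (c2.trans (c3.trans c1)) ?_
      intro he
      have he' : s y = s x := he
      have := congrArg s he'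
      rw [hss, hss] at this
      exact hxy.ne' this
    · have := hRanti (k x) hxy
      simp only [s]
      rw [← h]; exact this
  have hsPL : PLl s := by
    intro x
    constructor
    · obtain ⟨a, c, h⟩ := (hRPL (k x) x).1
      refine ⟨a, c, ?_⟩
      filter_upwards [h, Ioo_mem_nhdsGT (hk2 x)] with y hy1 hy2
      rw [spec (k x) y ((hk1 x).trans hy2.1.le) hy2.2.le, hy1]
    · obtain ⟨j, hj1, hj2⟩ : ∃ j : ℤ, (Φ ^ (j - 1)) b < x ∧ x ≤ (Φ ^ j) b := by
        rcases (hk1 x).lt_or_eq with h | h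
        · exact ⟨k x, h, (hk2 x).le⟩
        · refine ⟨k x - 1, ?_, h.ge⟩
          exact lt_of_lt_of_eq (hs (show k x - 1 - 1 < k x - 1 by omega)) h
      obtain ⟨a, c, h⟩ := (hRPL j x).2
      refine ⟨a, c, ?_⟩
      filter_upwards [h, Ioo_mem_nhdsLT hj1] with y hy1 hy2
      rw [spec j y hy2.1.le (hy2.2.le.trans hj2), hy1]
  have hsΦ : ∀ (i : ℤ) x, s ((Φ ^ i) x) = (Φ ^ (-i)) (s x) := by
    intro i x
    rw [spec (i + k x) ((Φ ^ i) x) ?_ ?_]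
    · simp only [s, R]
      rw [hz, hz]
      congr 2
      · congr 1; ring
      · congr 3; ring
    · rw [add_sub_assoc, ← hz]
      exact (zmono hΦ i).monotone (hk1 x)
    · rw [← hz]
      exact (zmono hΦ i).monotone (hk2 x).le
  have hcom : ∀ (i : ℤ) x, G ((Φ ^ i) x) = (Φ ^ i) (G x) := fun i x =>
    comm_app (cΦG.symm.zpow_right i) x
  have hbd : ∀ x, (Φ ^ (-1 : ℤ)) x ≤ G x ∧ G x ≤ Φ x := by
    intro x
    obtain ⟨p, -, hp⟩ := hpf x
    obtain ⟨j, hj1, hj2⟩ := cell hΦ hlt hup hdn p x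
    constructor
    · have h1 := hG.1.monotone hj1
      rw [hcom, hp] at h1
      refine le_trans ?_ h1
      have h2 := (zmono hΦ (-1)).monotone hj2.le
      rw [hz] at h2
      rwa [show -1 + j = j - 1 by ring] at h2
    · have h1 := hG.1.monotone hj2.le
      rw [hcom, hp] at h1
      refine le_trans h1 ?_
      have h2 := hΦ.1.monotone hj1
      rw [hΦz, hz] at h2
      rwa [show 1 + (j - 1) = j by ring] at h2
  have hhull : G b ≠ b → ∀ z, (∃ i : ℤ, (G ^ i) b ≤ z) → (∃ j : ℤ, z ≤ (G ^ j) b) →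
      Φ (S (Φ (S z))) = z := by
    intro hGb z h1 h2
    obtain ⟨p, hp1, hp2⟩ := hpf b
    have hPL1 : PLl (Φ * S : Perm ℝ) := hΦ.2.comp_anti hSP hS
    have hA : (Φ * S) * (Φ * S) ∈ PLG := ⟨hΦS.comp hΦS, hPL1.comp_anti hPL1 hΦS⟩
    have hSG' : ∀ x, S (G x) = G⁻¹ (S x) := by
      intro x
      apply G.injective
      rw [hSG]; simp
    have hSG'' : ∀ x, S (G⁻¹ x) = G (S x) := by
      intro x
      have := hSG (G⁻¹ x)
      rw [← this]; simp
    have hcG : ∀ x, Φ (G x) = G (Φ x) := comm_app cΦG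
    have hcG' : ∀ x, Φ (G⁻¹ x) = G⁻¹ (Φ x) := comm_app cΦG.inv_right
    have cA : Commute ((Φ * S) * (Φ * S)) G := by
      ext x
      simp only [Perm.mul_apply]
      rw [hSG', hcG', hSG'', hcG]
    have := agree hA (one_mem PLG) hG cA (Commute.one_left G) hp2 hp1 hGb
      (by simp [hb]) z h1 h2
    simpa using this
  have hsS : ∀ x, (Φ ^ (-1 : ℤ)) b ≤ x → x ≤ b → s (G x) = S (G x) := by
    intro x hx1 hx2
    rcases lt_or_ge b (G x) with h | h
    · have h3 : G x ≤ G b := hG.1.monotone hx2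
      have hGb : G b ≠ b := fun he => by rw [he] at h3; exact absurd h (not_lt.2 h3)
      have h4 := hhull hGb (G x) ⟨0, by simpa using h.le⟩ ⟨1, by simpa using h3⟩
      rw [spec 1 (G x) (by simpa using h.le) (by simpa using h3.trans (hbd b).2)]
      simp only [R]
      have h5 : S (Φ (S (G x))) = (Φ ^ (-1 : ℤ)) (G x) := by
        apply Φ.injective
        rw [h4, hΦz, hz]; simp
      rw [← h5, hSS, hΦz, hz]; simp
    · rcases lt_or_ge (G x) ((Φ ^ (-1 : ℤ)) b) with h2 | h2
      · have h3 : Φ (G x) < b := by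
          have := hΦ.1 h2
          rw [hΦz ((Φ ^ (-1 : ℤ)) b), hz] at this
          simpa using this
        have h4 : b ≤ Φ x := by
          have := hΦ.1.monotone hx1
          rw [hΦz ((Φ ^ (-1 : ℤ)) b), hz] at this
          simpa using this
        have h5 : G b ≤ Φ (G x) := by
          rw [comm_app cΦG]
          exact hG.1.monotone h4
        have hGb : G b ≠ b := fun he => by rw [he] at h5; exact absurd h3 (not_lt.2 h5)
        have h6 := hhull hGb (Φ (G x)) ⟨1, by simpa using h5⟩ ⟨0, by simpa using h3.le⟩
        have h7 : S (Φ (S (Φ (G x)))) = G x := Φ.injective h6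
        rw [spec (-1) (G x) ?_ h2.le]
        · simp only [R, neg_neg, ← hΦz]
          rw [← hSS (Φ (S (Φ (G x)))), h7]
        · have h8 := (hbd x).1
          refine le_trans ?_ h8
          have := (zmono hΦ (-1)).monotone hx1
          rwa [hz] at this
      · rw [spec 0 (G x) (by simpa using h2) (by simpa using h)]
        simp only [R, neg_zero, zpow_zero, Perm.one_apply]
  refine ⟨Function.Involutive.toPerm s hss, hsanti, hsPL, hss, fun x => ?_, fun x => ?_⟩
  · change Φ (s (Φ x)) = s x
    rw [hΦz x, hsΦ, hΦz, hz]; simp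
  · change G (s (G x)) = s x
    set w := (Φ ^ (-(k x))) x with hw
    have hxw : x = (Φ ^ (k x)) w := by rw [hw, hz]; simp
    have hw1 : (Φ ^ (-1 : ℤ)) b ≤ w := by
      have := (zmono hΦ (-(k x))).monotone (hk1 x)
      rw [hz] at this
      rwa [show -(k x) + (k x - 1) = -1 by ring] at this
    have hw2 : w ≤ b := by
      have := (zmono hΦ (-(k x))).monotone (hk2 x).le
      rwa [hz, neg_add_cancel, zpow_zero, Perm.one_apply] at this
    have e1 : s (G x) = (Φ ^ (-(k x))) (S (G w)) := by
      rw [← hsS w hw1 hw2, ← hsΦ, ← hcom, ← hxw]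
    rw [e1, hcom, hSG]

lemma exp_eq_iff {x y : ℝ} :
    Circle.exp (2 * π * x) = Circle.exp (2 * π * y) ↔ ∃ m : ℤ, x = y + m := by
  rw [Circle.exp_eq_exp]
  have := Real.pi_pos
  refine exists_congr fun m => ⟨fun h => ?_, fun h => by rw [h]; ring⟩
  have h2 : (2 * π) * (x - (y + m)) = 0 := by linarith
  rcases mul_eq_zero.1 h2 with h3 | h3 <;> linarith

lemma exp_surj (z : Circle) : ∃ x : ℝ, Circle.exp (2 * π * x) = z := by
  obtain ⟨y, hy⟩ := Circle.exp_surjective z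
  refine ⟨y / (2 * π), ?_⟩
  rw [← hy]
  congr 1
  field_simp

lemma int_shift {E : ℝ → ℝ} {k : ℝ} (h : ∀ x, E (x + 1) = E x + k) (x : ℝ) (m : ℤ) :
    E (x + m) = E x + m * k := by
  induction m using Int.induction_on with
  | zero => simp
  | succ i ih => 
    push_cast at *
    rw [← add_assoc, h, ih]; ring
  | pred i ih => 
    push_cast at *
    have := h (x + (-(i : ℝ) - 1))
    rw [show x + (-(i : ℝ) - 1) + 1 = x + -(i : ℝ) by ring, ih] at this
    linarith

lemma lift_surj {f : Circle ≃ₜ Circle} {F : ℝ → ℝ} {k : ℤ} (hk : k * k = 1)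
    (h : IsLift f F k) : Function.Surjective F := by
  intro y
  obtain ⟨x, hx⟩ := exp_surj (f.symm (Circle.exp (2 * π * y)))
  have h1 := h.1 x
  rw [hx, f.apply_symm_apply] at h1
  obtain ⟨m, hm⟩ := exp_eq_iff.1 h1
  refine ⟨x + (m * k : ℤ), ?_⟩
  have hk' : (k : ℝ) * k = 1 := by exact_mod_cast hk
  rw [int_shift h.2, hm]; push_cast
  rw [mul_assoc, hk']; ring

/-- unit translation -/
def TT : Perm ℝ := Equiv.addRight 1

lemma TT_apply (x : ℝ) : TT x = x + 1 := rfl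

lemma TT_zpow (m : ℤ) (x : ℝ) : (TT ^ m) x = x + m := by
  induction m using Int.induction_on generalizing x with
  | zero => simp
  | succ i ih =>
    rw [zpow_add_one, Perm.mul_apply, ih, TT_apply]; push_cast; ring
  | pred i ih =>
    have h : TT⁻¹ x = x - 1 := by
      rw [Perm.inv_eq_iff_eq, TT_apply]; ring
    rw [zpow_sub_one, Perm.mul_apply, ih, h]; push_cast; ring

lemma TT_mem : TT ∈ PLG := by
  refine ⟨fun x y h => by simpa [TT_apply] using h, fun x => ⟨⟨1, 1, ?_⟩, ⟨1, 1, ?_⟩⟩⟩ <;>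
  exact Eventually.of_forall fun y => by simp [TT_apply]

lemma near {K : Perm ℝ} (hK : StrictMono K) (h1 : ∀ x, K (x + 1) = K x + 1) {p : ℝ} (hp : K p = p)
    (x : ℝ) : |K x - x| < 1 := by
  have a1 := Int.floor_le (x - p)
  have a2 := Int.lt_floor_add_one (x - p)
  have b1 : K (p + ⌊x - p⌋) ≤ K x := hK.monotone (by linarith)
  have b2 : K x < K (p + ((⌊x - p⌋ + 1 : ℤ) : ℝ)) := hK (by push_cast; linarith)
  rw [int_shift h1, hp] at b1 b2
  push_cast at b2
  rw [abs_lt]; constructor <;> linarith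

lemma int_small {m : ℤ} (h : |(m : ℝ)| < 1) : m = 0 := by
  rw [← Int.cast_abs] at h
  have : |m| < 1 := by exact_mod_cast h
  exact Int.abs_lt_one_iff.1 this

lemma unit_fix {E : Perm ℝ} (hE : StrictMono E) (h1 : ∀ x, E (x + 1) = E x + 1) {p : ℝ}
    (hp : E p = p) (hm : ∀ x, ∃ m : ℤ, E x = x + m) (x : ℝ) : E x = x := by
  obtain ⟨m, h⟩ := hm x
  have := near hE h1 hp x
  rw [h, add_sub_cancel_left] at this
  rw [h, int_small this]; simp

lemma word {F T : Perm ℝ} (c : Commute F T) (a b e f i j : ℤ) :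
    (F ^ a * T ^ b) ^ i * (F ^ e * T ^ f) ^ j = F ^ (a * i + e * j) * T ^ (b * i + f * j) := by
  rw [(c.zpow_zpow a b).mul_zpow, (c.zpow_zpow e f).mul_zpow, ← zpow_mul, ← zpow_mul, ← zpow_mul,
    ← zpow_mul, zpow_add, zpow_add, mul_assoc, mul_assoc, ← mul_assoc (T ^ (b * i)),
    ← (c.zpow_zpow (e * j) (b * i)).eq]
  simp only [mul_assoc]

lemma rev_word {σ X Y : Perm ℝ} (hX : SemiconjBy σ X X⁻¹) (hY : SemiconjBy σ Y Y⁻¹)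
    (c : Commute X Y) (i j : ℤ) : SemiconjBy σ (X ^ i * Y ^ j) (X ^ i * Y ^ j)⁻¹ := by
  have := (hX.zpow_right i).mul_right (hY.zpow_right j)
  have e : (X ^ i * Y ^ j)⁻¹ = X⁻¹ ^ i * Y⁻¹ ^ j := by
    rw [(c.zpow_zpow i j).eq, mul_inv_rev, inv_zpow, inv_zpow]
  rw [e]
  exact this

lemma semi_iff {σ X : Perm ℝ} : SemiconjBy σ X X⁻¹ ↔ ∀ x, X (σ (X x)) = σ x := by
  constructor
  · intro h x
    have := congrArg (fun e : Perm ℝ => X (e x)) h.eq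
    simpa using this
  · intro h
    ext x
    apply X.injective
    simpa using h x

lemma core {F S : Perm ℝ} (hF : F ∈ PLG) (c : Commute F TT) (hS : StrictAnti S) (hSP : PLl S)
    (hST : ∀ x, S (x + 1) = S x + (-1)) (hSS : ∀ x, ∃ m : ℤ, S (S x) = x + m) {n : ℕ} (hn : 1 ≤ n)
    {k : ℤ} {x0 : ℝ} (hfix : (F ^ n) x0 = x0 + k)
    (hrev : ∀ x, ∃ m : ℤ, (F ^ n) (S ((F ^ n) x)) = S x + m) :
    ∃ σ : Perm ℝ, StrictAnti σ ∧ PLl σ ∧ (∀ x, σ (σ x) = x) ∧ (∀ x, TT (σ (TT x)) = σ x) ∧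
      (∀ x, F (σ (F x)) = σ x) := by
  -- S is an involution
  have hSm : ∀ x (m : ℤ), S (x + m) = S x - m := by
    intro x m; rw [int_shift hST]; ring
  have hSS1 : ∀ x, S (S x) = x := by
    obtain ⟨s0, hs0⟩ := anti_fix hS
    have := unit_fix (E := S * S) (hS.comp hS) (fun x => by
      simp only [Perm.mul_apply]
      rw [hST]
      have := hSm (S x) (-1)
      push_cast at this
      rw [this]; ring) (p := s0) (by simp [hs0]) (by simpa using hSS)
    simpa using this
  -- K
  set K : Perm ℝ := F ^ (n : ℤ) * TT ^ (-k) with hKd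
  have cKT : Commute K TT :=
    (c.zpow_left _).mul_left ((Commute.refl TT).zpow_left _)
  have hK : K ∈ PLG := mul_mem (zpow_mem hF _) (zpow_mem TT_mem _)
  have hFm : ∀ x (m : ℤ), (F ^ n) (x + m) = (F ^ n) x + m := by
    intro x m
    rw [← TT_zpow, comm_app ((c.pow_left n).zpow_right m), TT_zpow]
  have hKx : ∀ x, K x = (F ^ n) x - k := by
    intro x
    rw [hKd, Perm.mul_apply, TT_zpow, zpow_natCast, hFm]; push_cast; ring
  have hK1 : ∀ x, K (x + 1) = K x + 1 := fun x => comm_app cKT x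
  have hKm : ∀ x (m : ℤ), K (x + m) = K x + m := by
    intro x m; rw [int_shift hK1]; ring
  have hKx0 : K x0 = x0 := by rw [hKx, hfix]; ring
  have hKS : ∀ x, K (S (K x)) = S x := by
    have key : ∀ x, (S * K * S * K) x = x := by
      have hE : StrictMono (S * K * S * K : Perm ℝ) :=
        ((hS.comp_strictMono hK.1).comp hS).comp hK.1
      have hm : ∀ x, ∃ m : ℤ, (S * K * S * K) x = x + m := by
        intro x
        obtain ⟨m, hm⟩ := hrev x
        refine ⟨-m, ?_⟩
        simp only [Perm.mul_apply]
        have e0 := hSm ((F ^ n) x) (-k)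
        rw [Int.cast_neg] at e0
        rw [hKx x, sub_eq_add_neg, e0, sub_neg_eq_add, hKx]
        have e := hFm (S ((F ^ n) x)) k
        rw [e, hm, add_sub_cancel_right, hSm, hSS1]
        push_cast; ring
      have h1 : ∀ x, (S * K * S * K) (x + 1) = (S * K * S * K) x + 1 := by
        intro x
        simp only [Perm.mul_apply]
        rw [hK1, hST]
        have := hKm (S (K x)) (-1)
        push_cast at this
        rw [this]
        have := hSm (K (S (K x))) (-1)
        push_cast at this
        rw [this]; ring
      refine unit_fix hE h1 (p := K⁻¹ (S x0)) ?_ hm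
      obtain ⟨m, hm⟩ := hm (K⁻¹ (S x0))
      have h2 : (S * K * S * K) (K⁻¹ (S x0)) = S x0 := by
        simp [hSS1, hKx0]
      have h3 := near hK.1 hK1 hKx0 (K⁻¹ (S x0))
      rw [← Perm.mul_apply K, mul_inv_cancel, Perm.one_apply] at h3
      rw [h2] at hm
      have h4 : ((m : ℤ) : ℝ) = S x0 - K⁻¹ (S x0) := by linarith
      rw [← h4] at h3
      rw [int_small h3] at hm
      rw [h2]; simpa using hm
    intro x
    have := key x
    simp only [Perm.mul_apply] at this
    rw [← hSS1 (K (S (K x))), this]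
  -- arithmetic
  have hd0 : 0 < Int.gcd n k := Int.gcd_pos_of_ne_zero_left _ (by omega)
  obtain ⟨q, hq⟩ : ((Int.gcd n k : ℕ) : ℤ) ∣ n := Int.gcd_dvd_left ..
  obtain ⟨p, hp⟩ : ((Int.gcd n k : ℕ) : ℤ) ∣ k := Int.gcd_dvd_right ..
  have hbez := Int.gcd_eq_gcd_ab n k
  set l := Int.gcdA n k with hl
  set m := Int.gcdB n k with hm
  set d : ℕ := Int.gcd n k with hd
  have hd0' : (0 : ℤ) < d := by exact_mod_cast hd0
  have hbz : m * p + l * q = 1 := by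
    have : (d : ℤ) * (m * p + l * q) = d * 1 := by
      rw [mul_one]
      conv_rhs => rw [hbez]
      rw [show (n : ℤ) * l + k * m = l * n + m * k by ring]
      conv_rhs => rw [hq, hp]
      ring
    exact mul_left_cancel₀ hd0'.ne' this
  have hq0 : 0 < q := by
    have : (0 : ℤ) < d * q := by rw [← hq]; exact_mod_cast hn
    exact pos_of_mul_pos_right this hd0'.le
  set G : Perm ℝ := F ^ q * TT ^ (-p) with hGd
  set Φ : Perm ℝ := F ^ m * TT ^ l with hΦd
  have hG : G ∈ PLG := mul_mem (zpow_mem hF _) (zpow_mem TT_mem _)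
  have hΦ : Φ ∈ PLG := mul_mem (zpow_mem hF _) (zpow_mem TT_mem _)
  have cT : ∀ a b : ℤ, Commute (F ^ a * TT ^ b) TT := fun a b =>
    (c.zpow_left _).mul_left ((Commute.refl TT).zpow_left _)
  have cΦF : Commute Φ F := ((Commute.refl F).zpow_left m).mul_left (c.symm.zpow_left l)
  have cΦG : Commute Φ G := (cΦF.zpow_right q).mul_right ((cT m l).zpow_right (-p))
  have hGK : G ^ d = K := by
    have := word c q (-p) 0 0 d 0
    rw [zpow_natCast] at this
    simp only [zpow_zero, mul_one, mul_zero, add_zero] at this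
    rw [hGd, this, hKd, hq, hp]
    congr 2 <;> ring
  have hTw : TT = Φ ^ q * G ^ (-m) := by
    rw [hΦd, hGd, word c, show m * q + q * -m = 0 by ring,
      show l * q + -p * -m = m * p + l * q by ring, hbz]; simp
  have hFw : F = Φ ^ p * G ^ l := by
    rw [hΦd, hGd, word c, show m * p + q * l = m * p + l * q by ring,
      show l * p + -p * l = 0 by ring, hbz]; simp
  have hGx0 : G x0 = x0 := root_fix hG hd0 (by rw [hGK]; exact hKx0)
  have hGi : ∀ i : ℤ, G (x0 + i) = x0 + i := by
    intro i
    have h1 : ∀ x, G (x + 1) = G x + 1 := fun x => comm_app (cT q (-p)) x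
    rw [int_shift h1, mul_one, hGx0]
  have hpf : ∀ y, ∃ p ≤ y, G p = p := fun y =>
    ⟨x0 + ⌊y - x0⌋, by linarith [Int.floor_le (y - x0)], hGi _⟩
  have hGS : ∀ x, G (S (G x)) = S x := by
    have hSinv : S⁻¹ = S := by
      rw [inv_eq_iff_mul_eq_one]; ext x; simp [hSS1]
    have hH : S * G⁻¹ * S⁻¹ ∈ PLG := by
      rw [hSinv]
      have hGi := inv_mem hG
      have h1 : StrictAnti (S * G⁻¹ : Perm ℝ) := hS.comp_strictMono hGi.1
      have h2 : PLl (S * G⁻¹ : Perm ℝ) := hSP.comp_mono hGi.2 hGi.1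
      exact ⟨h1.comp hS, h2.comp_anti hSP hS⟩
    have hpow : G ^ d = (S * G⁻¹ * S⁻¹) ^ d := by
      rw [conj_pow, inv_pow, hGK, hSinv]
      have h := (semi_iff.2 hKS)
      have h2 : S * K⁻¹ = K * S := by simpa using h.inv_right.eq
      rw [h2, mul_assoc]
      ext x; simp [hSS1]
    have := root_unique hG hH hd0 hpow (by
      intro y
      obtain ⟨p, hp, hp2⟩ := hpf y
      exact ⟨p, hp, by simpa using zfix hp2 d⟩)
    intro x
    have h3 : G * S = S * G⁻¹ := by
      conv_lhs => rw [this]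
      simp
    have h4 := congrArg (fun e : Perm ℝ => e (G x)) h3
    simpa using h4
  have hval : ∀ M i : ℤ, (Φ ^ (q * M)) (x0 + i) = x0 + i + M := by
    intro M i
    have e : Φ ^ (q * M) = TT ^ M * G ^ (m * M) := by
      have := word c 0 1 q (-p) M (m * M)
      simp only [zpow_zero, one_mul, zpow_one] at this
      rw [hGd, this]
      have := word c m l 0 0 (q * M) 0
      simp only [zpow_zero, mul_one, mul_zero, add_zero] at this
      rw [hΦd, this]
      congr 2
      · ring
      · linear_combination (M : ℤ) * hbz
    rw [e, Perm.mul_apply, zfix (hGi i), TT_zpow]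
  have hupN : ∀ x y, ∃ M : ℕ, y < (Φ ^ (q * M)) x := by
    intro x y
    obtain ⟨M, hM⟩ := exists_nat_gt (y - (x0 + ⌊x - x0⌋))
    refine ⟨M, ?_⟩
    have h1 : (Φ ^ (q * (M : ℤ))) (x0 + ⌊x - x0⌋) ≤ (Φ ^ (q * (M : ℤ))) x :=
      (zmono hΦ _).monotone (by linarith [Int.floor_le (x - x0)])
    rw [hval] at h1
    push_cast at h1
    linarith
  have hdn : ∀ x y, ∃ M : ℤ, (Φ ^ M) x < y := by
    intro x y
    obtain ⟨M, hM⟩ := exists_nat_gt ((x0 + ⌈x - x0⌉) - y)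
    refine ⟨q * (-M : ℤ), ?_⟩
    have h1 : (Φ ^ (q * (-M : ℤ))) x ≤ (Φ ^ (q * (-M : ℤ))) (x0 + ⌈x - x0⌉) :=
      (zmono hΦ _).monotone (by linarith [Int.le_ceil (x - x0)])
    rw [hval] at h1
    push_cast at h1
    linarith
  have hlt : ∀ x, x < Φ x := by
    intro x
    by_contra hc
    obtain ⟨M, hM⟩ := hupN x x
    have h1 := pow_anti_pt hΦ (not_lt.1 hc) (Nat.zero_le (q.toNat * M))
    have h2 : q * (M : ℤ) = ((q.toNat * M : ℕ) : ℤ) := by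
      push_cast; rw [Int.toNat_of_nonneg hq0.le]
    rw [h2, zpow_natCast] at hM
    simp only [pow_zero, Perm.one_apply] at h1
    linarith
  obtain ⟨σ, s1, s2, s3, s4, s5⟩ := step2 hΦ hG hS hSP hSS1 hGS cΦG hlt
    (fun x y => (hupN x y).imp' (fun M : ℕ => q * (M : ℤ)) (fun _ h => h)) hdn hpf
  refine ⟨σ, s1, s2, s3, ?_, ?_⟩
  · rw [← semi_iff] at *
    rw [hTw]
    exact rev_word s4 s5 cΦG q (-m)
  · rw [← semi_iff] at *
    conv => rw [hFw]
    exact rev_word s4 s5 cΦG p l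

lemma descend {σ : Perm ℝ} (hs : StrictAnti σ) (hT : ∀ x, σ (x + 1) = σ x + (-1))
    (hss : ∀ x, σ (σ x) = x) : ∃ τ : Circle ≃ₜ Circle,
      ∀ x : ℝ, τ (Circle.exp (2 * π * x)) = Circle.exp (2 * π * σ x) := by
  choose g hg using exp_surj
  let t : Circle → Circle := fun z => Circle.exp (2 * π * σ (g z))
  have ht : ∀ x : ℝ, t (Circle.exp (2 * π * x)) = Circle.exp (2 * π * σ x) := by
    intro x
    obtain ⟨m, hm⟩ := exp_eq_iff.1 (hg (Circle.exp (2 * π * x)))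
    simp only [t]
    rw [hm, int_shift hT]
    exact exp_eq_iff.2 ⟨-m, by push_cast; ring⟩
  have htt : Function.Involutive t := by
    intro z
    obtain ⟨x, rfl⟩ := exp_surj z
    rw [ht x, ht (σ x), hss]
  have hq : IsQuotientMap (fun x : ℝ => Circle.exp (2 * π * x)) := by
    apply IsOpenMap.isQuotientMap
    · exact Circle.isCoveringMap_exp.isLocalHomeomorph.isOpenMap.comp
        (Homeomorph.mulLeft₀ (2 * π) (by positivity)).isOpenMap
    · fun_prop
    · exact exp_surj
  have hc : Continuous t := by
    rw [hq.continuous_iff]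
    have : (t ∘ fun x : ℝ => Circle.exp (2 * π * x)) = fun x => Circle.exp (2 * π * σ x) :=
      funext ht
    rw [this]
    have := anti_cont hs
    fun_prop
  exact ⟨⟨htt.toPerm, hc, hc⟩, ht⟩

/-- Let `f ∈ PL⁺(S¹)` and `n ≥ 1` with `fⁿ` having a fixed point.  Then `f` is
strongly reversible in `PL(S¹)` by an element of `PL⁻(S¹)` if and only if `fⁿ` is.
(Strong reversibility of `g` by the involution `τ`, `τ g τ = g⁻¹`, is expressed
inverse-free as `g ∘ τ ∘ g = τ`.) -/
theorem strongly_reversible_iff_power_strongly_reversible (f : Circle ≃ₜ Circle)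
    (hf : PLplus f) (n : ℕ) (hn : 1 ≤ n)
    (hfix : ∃ z : Circle, (⇑f)^[n] z = z) :
    (∃ τ : Circle ≃ₜ Circle, PLminus τ ∧ (∀ z : Circle, τ (τ z) = z) ∧
        ∀ z : Circle, f (τ (f z)) = τ z) ↔
      (∃ τ : Circle ≃ₜ Circle, PLminus τ ∧ (∀ z : Circle, τ (τ z) = z) ∧
        ∀ z : Circle, (⇑f)^[n] (τ ((⇑f)^[n] z)) = τ z) := by
  constructor
  · rintro ⟨τ, h1, h2, h3⟩
    refine ⟨τ, h1, h2, ?_⟩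
    clear hn hfix
    induction n with
    | zero => intro z; rfl
    | succ k ih =>
      intro z
      rw [Function.iterate_succ_apply, Function.iterate_succ_apply', h3, ih]
  · rintro ⟨τ, ⟨S0, hS0, hSP, hSL⟩, h2, h3⟩
    obtain ⟨F0, hF0, hFP, hFL⟩ := hf
    have hFs : Function.Surjective F0 := lift_surj (k := 1) (by norm_num) (by simpa using hFL)
    have hSs : Function.Surjective S0 := lift_surj (k := -1) (by norm_num) (by simpa using hSL)
    let F : Perm ℝ := Equiv.ofBijective F0 ⟨hF0.injective, hFs⟩
    let S : Perm ℝ := Equiv.ofBijective S0 ⟨hS0.injective, hSs⟩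
    have hF1 : ∀ x : ℝ, f (Circle.exp (2 * π * x)) = Circle.exp (2 * π * F x) := hFL.1
    have hS1 : ∀ x : ℝ, τ (Circle.exp (2 * π * x)) = Circle.exp (2 * π * S x) := hSL.1
    have hFn : ∀ (j : ℕ) (x : ℝ), (⇑f)^[j] (Circle.exp (2 * π * x)) =
        Circle.exp (2 * π * (F ^ j) x) := by
      intro j
      induction j with
      | zero => intro x; simp
      | succ i ih =>
        intro x
        rw [Function.iterate_succ_apply', ih, hF1, pow_succ', Perm.mul_apply]
    have hF : F ∈ PLG := ⟨hF0, hFP.pll⟩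
    have cF : Commute F TT := by
      ext x
      exact hFL.2 x
    obtain ⟨z, hz⟩ := hfix
    obtain ⟨x0, rfl⟩ := exp_surj z
    rw [hFn] at hz
    obtain ⟨k, hk⟩ := exp_eq_iff.1 hz
    obtain ⟨σ, s1, s2, s3, s4, s5⟩ := core (F := F) (S := S) hF cF hS0 hSP.pll hSL.2
      (fun x => exp_eq_iff.1 (by rw [← hS1, ← hS1, h2])) hn hk
      (fun x => exp_eq_iff.1 (by rw [← hFn, ← hS1, ← hFn, ← hS1, h3]))
    have hσT : ∀ x, σ (x + 1) = σ x + (-1) := by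
      intro x
      have := s4 x
      rw [TT_apply, TT_apply] at this
      linarith
    obtain ⟨t, ht⟩ := descend s1 hσT s3
    refine ⟨t, ⟨σ, s1, s2.isPLFun, ht, hσT⟩, fun z => ?_, fun z => ?_⟩
    · obtain ⟨x, rfl⟩ := exp_surj z
      rw [ht, ht, s3]
    · obtain ⟨x, rfl⟩ := exp_surj z
      rw [hF1, ht, hF1, ht, s5]
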